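/- Let K be a field with char(K) = 0 and f ∈ K[x] with deg f > 1. Then the bivariate polynomial (f(x) − f(y))/(x − y) ∈ K[x, y] is irreducible over K if and only if the monodromy group Mon(f) is a doubly transitive permutation group. -/

import Mathlib

open Polynomial

noncomputable section

/-- The polynomial `f(X) - t` over `K(t)`, whose Galois group (viewed as a permutation group
of the roots in a splitting field) is the monodromy group `Mon(f)` of `f`. -/
def monodromyPoly (K : Type*) [Field K] (f : K[X]) : Polynomial (RatFunc K) :=
  f.map (algebraMap K (RatFunc K)) - C RatFunc.X

/-- A group action is doubly transitive if any ordered pair of distinct points can be mapped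
to any other ordered pair of distinct points. -/
def IsDoublyTransitive (G α : Type*) [Group G] [MulAction G α] : Prop :=
  ∀ x₁ x₂ y₁ y₂ : α, x₁ ≠ x₂ → y₁ ≠ y₂ → ∃ g : G, g • x₁ = y₁ ∧ g • x₂ = y₂


/-- A polynomial whose leading coefficient is a unit is primitive. -/
lemma isPrimitive_of_isUnit_leadingCoeff {R : Type*} [CommSemiring R] {p : R[X]}
    (hp : IsUnit p.leadingCoeff) : p.IsPrimitive := fun r hr =>
  isUnit_of_dvd_unit ((C_dvd_iff_dvd_coeff r p).1 hr p.natDegree) hp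

/-- Gauss's lemma along an injection of a GCD domain into a field consisting of quotients. -/
lemma irreducible_iff_irreducible_map_of_quotients {A E : Type*} [CommRing A] [IsDomain A]
    [NormalizedGCDMonoid A] [Field E] (φ : A →+* E) (hφ : Function.Injective φ)
    (hquot : ∀ z : E, ∃ a b, z = φ a / φ b) {p : A[X]} (hp : p.IsPrimitive) :
    Irreducible p ↔ Irreducible (p.map φ) := by
  let _ := φ.toAlgebra
  have : FaithfulSMul A E := (faithfulSMul_iff_algebraMap_injective A E).2 hφ
  have : IsFractionRing A E := IsFractionRing.of_field A E hquot
  exact hp.irreducible_iff_irreducible_map_fraction_map (K := E)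

/-- A separable polynomial that splits in a normal extension is irreducible iff the Galois group
acts transitively on its roots. -/
lemma irreducible_iff_forall_roots_exists_algEquiv {E L : Type*} [Field E] [Field L] [Algebra E L]
    [Normal E L] {p : E[X]} (hsep : p.Separable) (hspl : (p.map (algebraMap E L)).Splits)
    (hdeg : p.natDegree ≠ 0) :
    Irreducible p ↔ ∀ x y : L, aeval x p = 0 → aeval y p = 0 → ∃ σ : L ≃ₐ[E] L, σ x = y := by
  constructor
  · intro h x y hx hy
    obtain ⟨σ, hσ⟩ := (Normal.minpoly_eq_iff_mem_orbit L).1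
      ((minpoly.eq_of_irreducible h hy).symm.trans (minpoly.eq_of_irreducible h hx))
    exact ⟨σ, hσ⟩
  · intro h
    have hp0 : p ≠ 0 := hsep.ne_zero
    have hroot : ∀ a : E[X], a ∣ p → ¬ IsUnit a → ∃ x : L, aeval x a = 0 := by
      intro a ha hau
      have hspl' : (a.map (algebraMap E L)).Splits :=
        hspl.of_dvd (Polynomial.map_ne_zero hp0) (Polynomial.map_dvd _ ha)
      have hdeg' : (a.map (algebraMap E L)).degree ≠ 0 := by
        rw [degree_map]
        exact fun hd => hau (isUnit_iff_degree_eq_zero.2 hd)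
      obtain ⟨x, hx⟩ := hspl'.exists_eval_eq_zero hdeg'
      exact ⟨x, by rwa [eval_map_algebraMap] at hx⟩
    refine ⟨fun hu => hdeg (natDegree_eq_zero_of_isUnit hu), fun a b hab => ?_⟩
    by_contra! hcon
    obtain ⟨x, hx⟩ := hroot a ⟨b, hab⟩ hcon.1
    obtain ⟨y, hy⟩ := hroot b ⟨a, hab.trans (mul_comm a b)⟩ hcon.2
    obtain ⟨σ, rfl⟩ := h x y (by rw [hab, map_mul, hx, zero_mul])
      (by rw [hab, map_mul, hy, mul_zero])
    have hσ : aeval (σ x) a = 0 := by rw [aeval_algHom_apply, hx, map_zero]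
    rw [hab] at hsep
    obtain ⟨u, v, huv⟩ := hsep.isCoprime
    have := congrArg (aeval (σ x)) huv
    simp [hσ, hy] at this

/-- The polynomial `f(X) - t` is irreducible over `K(t)`. -/
lemma irreducible_monodromyPoly {K : Type*} [Field K] (f : K[X]) (hf : 0 < f.natDegree) :
    Irreducible (monodromyPoly K f) := by
  have hmap : monodromyPoly K f = (f.map C - C X : K[X][X]).map (algebraMap K[X] (RatFunc K)) := by
    simp [monodromyPoly, Polynomial.map_map, RatFunc.algebraMap_X]
  have hlc : (f.map C - C X : K[X][X]).leadingCoeff = C f.leadingCoeff := by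
    rw [leadingCoeff_sub_of_degree_lt, leadingCoeff_map_of_injective C_injective]
    rw [degree_map_eq_of_injective C_injective]
    exact degree_C_le.trans_lt (natDegree_pos_iff_degree_pos.1 hf)
  have hprim : (f.map C - C X : K[X][X]).IsPrimitive := by
    apply isPrimitive_of_isUnit_leadingCoeff
    rw [hlc]
    exact isUnit_C.2 (isUnit_iff_ne_zero.2 (leadingCoeff_ne_zero.2 (by rintro rfl; simp at hf)))
  classical
  rw [hmap, ← hprim.irreducible_iff_irreducible_map_fraction_map (K := RatFunc K),
    ← MulEquiv.irreducible_iff (Bivariate.swap (R := K)), map_sub, Bivariate.swap_map_C,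
    Bivariate.swap_X, ← neg_sub]
  exact (Associated.refl (X - C f)).neg_left.irreducible_iff.2 (irreducible_X_sub_C f)

lemma aeval_monodromyPoly_eq_zero_iff {K L : Type*} [Field K] [Field L] [Algebra K L]
    [Algebra (RatFunc K) L] [IsScalarTower K (RatFunc K) L] {f : K[X]} {α : L} :
    aeval α (monodromyPoly K f) = 0 ↔ aeval α f = algebraMap (RatFunc K) L RatFunc.X := by
  rw [monodromyPoly, map_sub, aeval_C, aeval_map_algebraMap, sub_eq_zero]

lemma transcendental_of_aeval_monodromyPoly {K L : Type*} [Field K] [Field L] [Algebra K L]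
    [Algebra (RatFunc K) L] [IsScalarTower K (RatFunc K) L] {f : K[X]} {α : L}
    (hα : aeval α (monodromyPoly K f) = 0) : Transcendental K α := by
  have h : Transcendental K (aeval α f) := by
    rw [aeval_monodromyPoly_eq_zero_iff.1 hα,
      transcendental_algebraMap_iff (algebraMap (RatFunc K) L).injective]
    exact RatFunc.transcendental_X
  exact (transcendental_aeval_iff.1 h).1

open scoped IntermediateField in
/-- If `f(α) = t`, then `K(t)(α)` consists of quotients of polynomials in `α` over `K`. -/
lemma exists_eq_aeval_div_aeval {K L : Type*} [Field K] [Field L] [Algebra K L]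
    [Algebra (RatFunc K) L] [IsScalarTower K (RatFunc K) L] {f : K[X]} {α : L}
    (hα : aeval α (monodromyPoly K f) = 0) {z : L} (hz : z ∈ (RatFunc K)⟮α⟯) :
    ∃ a b : K[X], z = aeval α a / aeval α b := by
  have hinj : Function.Injective (aeval α : K[X] →ₐ[K] L) :=
    transcendental_iff_injective.1 (transcendental_of_aeval_monodromyPoly hα)
  let ψ : RatFunc K →ₐ[K] L := RatFunc.liftAlgHom (aeval α)
    (nonZeroDivisors_le_comap_nonZeroDivisors_of_injective _ hinj)
  have hψ : ∀ p q : K[X], ψ (algebraMap _ _ p / algebraMap _ _ q) = aeval α p / aeval α q :=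
    fun p q => RatFunc.liftAlgHom_apply_div _ _ _ _
  have hp : ∀ p : K[X], algebraMap (RatFunc K) L (algebraMap K[X] (RatFunc K) p) =
      aeval α (p.comp f) := by
    intro p
    rw [aeval_comp, aeval_monodromyPoly_eq_zero_iff.1 hα, aeval_algebraMap_apply,
      RatFunc.aeval_X_left_eq_algebraMap]
  have hmem : z ∈ ψ.fieldRange := by
    induction hz using IntermediateField.adjoin_induction with
    | mem x hx =>
      obtain rfl : x = α := hx
      exact ⟨algebraMap _ _ X / algebraMap _ _ 1, (hψ X 1).trans (by simp)⟩
    | algebraMap x =>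
      induction x using RatFunc.induction_on with
      | f p q hq =>
        refine ⟨algebraMap _ _ (p.comp f) / algebraMap _ _ (q.comp f), ?_⟩
        rw [map_div₀ (algebraMap (RatFunc K) L), hp, hp]
        exact hψ _ _
    | add x y _ _ hx hy => exact add_mem hx hy
    | inv x _ hx => exact inv_mem hx
    | mul x y _ _ hx hy => exact mul_mem hx hy
  obtain ⟨w, rfl⟩ := hmem
  induction w using RatFunc.induction_on with
  | f p q hq => exact ⟨p, q, hψ p q⟩

open scoped IntermediateField in
/-- For a root `α` of `f(X) - t`, the polynomial `(f(x) - f(y))/(x - y)` is irreducible iff the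
stabilizer of `α` in the Galois group acts transitively on the remaining roots. -/
lemma irreducible_iff_stabilizer_transitive {K L : Type*} [Field K] [CharZero K] [Field L]
    [Algebra K L] [Algebra (RatFunc K) L] [IsScalarTower K (RatFunc K) L] [Normal (RatFunc K) L]
    {f : K[X]} (hf : 1 < f.natDegree) {q : K[X][X]}
    (hq : (X - C X) * q = f.map (C : K →+* K[X]) - C f)
    (hspl : ((monodromyPoly K f).map (algebraMap (RatFunc K) L)).Splits) {α : L}
    (hα : aeval α (monodromyPoly K f) = 0) :
    Irreducible q ↔ ∀ β γ : L, aeval β (monodromyPoly K f) = 0 →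
      aeval γ (monodromyPoly K f) = 0 → β ≠ α → γ ≠ α →
      ∃ σ : L ≃ₐ[RatFunc K] L, σ α = α ∧ σ β = γ := by
  set P := monodromyPoly K f with hP
  let E := (RatFunc K)⟮α⟯
  let a : E := IntermediateField.AdjoinSimple.gen (RatFunc K) α
  have hflt : (C f : K[X][X]).degree < (f.map (C : K →+* K[X])).degree := by
    rw [degree_map_eq_of_injective C_injective]
    exact degree_C_le.trans_lt (natDegree_pos_iff_degree_pos.1 (by lia))
  have hlc : q.leadingCoeff = C f.leadingCoeff := by
    have := congrArg leadingCoeff hq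
    rwa [leadingCoeff_mul, leadingCoeff_X_sub_C, one_mul, leadingCoeff_sub_of_degree_lt hflt,
      leadingCoeff_map_of_injective C_injective] at this
  have hlcu : IsUnit q.leadingCoeff := by
    rw [hlc]
    exact isUnit_C.2 (isUnit_iff_ne_zero.2 (leadingCoeff_ne_zero.2 (by rintro rfl; simp at hf)))
  have hdeg : q.natDegree ≠ 0 := by
    have h := congrArg natDegree hq
    rw [natDegree_mul (X_sub_C_ne_zero _) (by rintro rfl; simp at hlcu), natDegree_X_sub_C,
      natDegree_sub_eq_left_of_natDegree_lt, natDegree_map_eq_of_injective C_injective] at h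
    · lia
    · rw [natDegree_map_eq_of_injective C_injective, natDegree_C]; lia
  let φ : K[X] →+* E := 
    eval₂RingHom ((algebraMap (RatFunc K) E).comp (algebraMap K (RatFunc K))) a
  have hcoe : ∀ p : K[X], ((φ p : E) : L) = aeval α p := fun p => by
    change algebraMap E L (eval₂ _ a p) = _
    rw [hom_eval₂, aeval_def, IsScalarTower.algebraMap_eq K (RatFunc K) L]
    rfl
  have hφ : Function.Injective φ := fun x y hxy =>
    transcendental_iff_injective.1 (transcendental_of_aeval_monodromyPoly hα)
      (by rw [← hcoe, ← hcoe, hxy])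
  have hquot : ∀ z : E, ∃ x y, z = φ x / φ y := by
    intro z
    obtain ⟨x, y, hxy⟩ := exists_eq_aeval_div_aeval hα z.2
    exact ⟨x, y, Subtype.ext (by rw [hxy, ← hcoe, ← hcoe]; rfl)⟩
  have hfac : (X - C a) * q.map φ = P.map (algebraMap (RatFunc K) E) := by
    have h := congrArg (Polynomial.map φ) hq
    have h1 : φ.comp C = (algebraMap (RatFunc K) E).comp (algebraMap K (RatFunc K)) := by
      ext x
      simp only [RingHom.comp_apply]
      rw [hcoe, aeval_C, IsScalarTower.algebraMap_apply K (RatFunc K) L]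
      rfl
    have h2 : φ f = algebraMap (RatFunc K) E RatFunc.X :=
      Subtype.ext (by rw [hcoe, aeval_monodromyPoly_eq_zero_iff.1 hα]; rfl)
    have h3 : φ X = a := eval₂_X _ _
    simpa [Polynomial.map_map, h1, h2, h3, hP, monodromyPoly] using h
  have hPirr : Irreducible P := irreducible_monodromyPoly f (by lia)
  have hsep : (P.map (algebraMap (RatFunc K) E)).Separable := hPirr.separable.map
  have hPspl : ((P.map (algebraMap (RatFunc K) E)).map (algebraMap E L)).Splits := by
    rwa [Polynomial.map_map, ← IsScalarTower.algebraMap_eq]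
  have hdvd : q.map φ ∣ P.map (algebraMap (RatFunc K) E) := ⟨_, by rw [← hfac, mul_comm]⟩
  have hqroot : ∀ β : L, aeval β (q.map φ) = 0 ↔ aeval β P = 0 ∧ β ≠ α := by
    intro β
    have h := congrArg (aeval β) hfac
    rw [map_mul, aeval_map_algebraMap, map_sub, aeval_X, aeval_C] at h
    change (β - α) * _ = _ at h
    constructor
    · intro hβ
      refine ⟨by rw [← h, hβ, mul_zero], ?_⟩
      rintro rfl
      rw [← hfac] at hsep
      obtain ⟨u, v, huv⟩ := hsep.isCoprime
      have := congrArg (aeval β) huv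
      have ha : algebraMap E L a = β := rfl
      simp [hβ, ha] at this
    · rintro ⟨hβ, hne⟩
      rw [hβ] at h
      exact (mul_eq_zero.1 h).resolve_left (sub_ne_zero.2 hne)
  classical
  rw [irreducible_iff_irreducible_map_of_quotients φ hφ hquot
      (isPrimitive_of_isUnit_leadingCoeff hlcu),
    irreducible_iff_forall_roots_exists_algEquiv (L := L) (hsep.of_dvd hdvd)
      (hPspl.of_dvd (Polynomial.map_ne_zero hsep.ne_zero) (Polynomial.map_dvd _ hdvd))
      (by rwa [natDegree_map_eq_of_injective hφ])]
  constructor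
  · intro h β γ hβ hγ hβα hγα
    obtain ⟨σ, hσ⟩ := h β γ ((hqroot β).2 ⟨hβ, hβα⟩) ((hqroot γ).2 ⟨hγ, hγα⟩)
    exact ⟨σ.restrictScalars (RatFunc K), σ.commutes a, hσ⟩
  · intro h β γ hβ hγ
    rw [hqroot] at hβ hγ
    obtain ⟨σ, hσα, hσ⟩ := h β γ hβ.1 hγ.1 hβ.2 hγ.2
    have hfix : ∀ x ∈ E, σ • x = x :=
      (IntermediateField.forall_mem_adjoin_smul_eq_self_iff (RatFunc K) σ).2 (by simpa using hσα)
    exact ⟨IntermediateField.fixingSubgroupEquiv E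
      ⟨σ, (IntermediateField.mem_fixingSubgroup_iff E σ).2 hfix⟩, hσ⟩

/-- **Lemma (Fried).** Let `char K = 0` and `f ∈ K[x]` with `deg f > 1`. Then the bivariate
polynomial `(f(x) − f(y))/(x − y)` (here `q ∈ (K[y])[x]` with `(x − y)·q = f(x) − f(y)`) is
irreducible over `K` iff the monodromy group of `f` is doubly transitive. -/
theorem stmt9 {K : Type*} [Field K] [CharZero K] (f : K[X]) (hf : 1 < f.natDegree)
    (q : Polynomial (Polynomial K))
    (hq : (X - C X) * q = f.map (C : K →+* K[X]) - C f) :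
    Irreducible q ↔
      IsDoublyTransitive (monodromyPoly K f).Gal
        ((monodromyPoly K f).rootSet (monodromyPoly K f).SplittingField) := by
  have hirr : Irreducible (monodromyPoly K f) := irreducible_monodromyPoly f (by lia)
  have hspl := SplittingField.splits (monodromyPoly K f)
  have hmem : ∀ x : (monodromyPoly K f).SplittingField,
      x ∈ (monodromyPoly K f).rootSet (monodromyPoly K f).SplittingField ↔
        aeval x (monodromyPoly K f) = 0 := fun x => by
    rw [mem_rootSet, and_iff_right hirr.ne_zero]
  constructor
  · intro h x₁ x₂ y₁ y₂ hx hy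
    obtain ⟨g, hg⟩ : ∃ g : (monodromyPoly K f).Gal, g • x₁ = y₁ := by
      obtain ⟨σ, hσ⟩ := (irreducible_iff_forall_roots_exists_algEquiv hirr.separable hspl
        hirr.natDegree_pos.ne').1 hirr x₁ y₁ ((hmem _).1 x₁.2) ((hmem _).1 y₁.2)
      exact ⟨σ, Subtype.ext hσ⟩
    obtain ⟨σ, hσ₁, hσ₂⟩ := (irreducible_iff_stabilizer_transitive hf hq hspl
      ((hmem _).1 y₁.2)).1 h (g • x₂ : _) y₂ ((hmem _).1 (g • x₂).2) ((hmem _).1 y₂.2)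
      (fun h => hx (MulAction.injective g (hg.trans (Subtype.ext h).symm)))
      (fun h => hy (Subtype.ext h).symm)
    refine ⟨(show (monodromyPoly K f).Gal from σ) * g, ?_, ?_⟩
    · rw [mul_smul, hg]
      exact Subtype.ext hσ₁
    · rw [mul_smul]
      exact Subtype.ext hσ₂
  · intro h
    obtain ⟨α, hα⟩ := hspl.exists_eval_eq_zero
      (by rw [degree_map]; exact (degree_pos_of_irreducible hirr).ne')
    rw [eval_map_algebraMap] at hα
    refine (irreducible_iff_stabilizer_transitive hf hq hspl hα).2 fun β γ hβ hγ hβα hγα => ?_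
    obtain ⟨g, hg₁, hg₂⟩ := h ⟨α, (hmem _).2 hα⟩ ⟨β, (hmem _).2 hβ⟩ ⟨α, (hmem _).2 hα⟩
      ⟨γ, (hmem _).2 hγ⟩ (fun h => hβα (congrArg Subtype.val h).symm)
      (fun h => hγα (congrArg Subtype.val h).symm)
    exact ⟨g, congrArg Subtype.val hg₁, congrArg Subtype.val hg₂⟩
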